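/- arXiv:1911.03542 — 2 statements merged into one kernel-verified Lean document; each statement's English description precedes it below -/
import Mathlib

section
/- For a string S of length n and index i ∈ [1,n], let nss(i) = min{j ∈ (i, n+1] : S_i ≻ S_j} with S_{n+1} the sentinel suffix. Then the length λ[i] of the longest Lyndon word starting at position i equals nss(i) − i. -/
variable {α : Type*} [LinearOrder α]

/-- A Lyndon word: nonempty and strictly smaller than all of its proper nonempty suffixes. -/
def IsLyndon (s : List α) : Prop :=
  s ≠ [] ∧ ∀ i, 0 < i → i < s.length → List.Lex (· < ·) s (s.drop i)

/-- The `i`-th suffix of `S` (1-indexed); `sfx S 0 = []` plays the role of the sentinel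
suffix `S₀ = $`, and `sfx S (n+1) = []` plays the role of `S_{n+1} = $`
(the empty list is lexicographically smaller than every nonempty list). -/
def sfx (S : List α) (i : ℕ) : List α := if i = 0 then [] else S.drop (i - 1)

open scoped Classical in
/-- `pss S j = max {k ∈ [0,j) : S_k ≺ S_j}`. -/
noncomputable def pss (S : List α) (j : ℕ) : ℕ :=
  Nat.findGreatest (fun k => List.Lex (· < ·) (sfx S k) (sfx S j)) (j - 1)

/-- `nss S i = min {j ∈ (i, n+1] : S_j ≺ S_i}`. -/
noncomputable def nss (S : List α) (i : ℕ) : ℕ :=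
  sInf {j | i < j ∧ j ≤ S.length + 1 ∧ List.Lex (· < ·) (sfx S j) (sfx S i)}

/-- Length of the longest common prefix of two lists. -/
def lcp : List α → List α → ℕ
  | a :: s, b :: t => if a = b then lcp s t + 1 else 0
  | _, _ => 0

/-- The PSS closure: all iterates of `pss` starting from `j`. -/
noncomputable def pssClosure (S : List α) (j : ℕ) : Set ℕ :=
  {k | ∃ m, (pss S)^[m] j = k}

open scoped Classical in
/-- Size of the subtree of node `i` in the PSS tree of `S`. -/
noncomputable def subtreeSize (S : List α) (i : ℕ) : ℕ :=
  ((Finset.range (S.length + 1)).filter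
    (fun j => j = i ∨ ∃ m, 0 < m ∧ (pss S)^[m] j = i)).card

open scoped Classical in
/-- `lam S i`: length of the longest Lyndon word starting at position `i` (1-indexed). -/
noncomputable def lam (S : List α) (i : ℕ) : ℕ :=
  Nat.findGreatest (fun ℓ => IsLyndon ((S.drop (i - 1)).take ℓ)) (S.length + 1 - i)

theorem lexB {u w : List α} (h : List.Lex (· < ·) u w) :
    (∃ x, w = u ++ x) ∨ ∀ x y, List.Lex (· < ·) (u ++ x) (w ++ y) := by
  induction h with
  | nil => left; exact ⟨_, rfl⟩
  | cons h ih =>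
    rcases ih with ⟨x, rfl⟩ | ih
    · left; exact ⟨x, rfl⟩
    · right; intro x y; exact List.Lex.cons (ih x y)
  | rel h => right; intro x y; exact List.Lex.rel h

theorem lex_irr (u : List α) : ¬ List.Lex (· < ·) u u := fun h => lt_irrefl u h

theorem lex_tr {a b c : List α} (h : List.Lex (· < ·) a b) (h' : List.Lex (· < ·) b c) :
    List.Lex (· < ·) a c := lt_trans (a := a) (b := b) (c := c) h h'

theorem lex_tri (a b : List α) : List.Lex (· < ·) a b ∨ a = b ∨ List.Lex (· < ·) b a :=
  lt_trichotomy a b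

theorem lexC (u : List α) {a b : List α} (h : List.Lex (· < ·) (u ++ a) (u ++ b)) :
    List.Lex (· < ·) a b := by
  induction u with
  | nil => exact h
  | cons c u ih =>
    cases h with
    | cons h => exact ih h
    | rel h => exact absurd h (lt_irrefl _)

theorem core1 (T : List α) (d : ℕ) (hd : 0 < d) (hd' : d ≤ T.length)
    (hlt : List.Lex (· < ·) (T.drop d) T)
    (hmin : ∀ k, 0 < k → k < d → ¬ List.Lex (· < ·) (T.drop k) T) :
    IsLyndon (T.take d) := by
  have hmin' : ∀ k, 0 < k → k < d → List.Lex (· < ·) T (T.drop k) := by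
    intro k hk hkd
    rcases lex_tri T (T.drop k) with h | h | h
    · exact h
    · have := congrArg List.length h
      simp at this; omega
    · exact absurd h (hmin k hk hkd)
  refine ⟨?_, ?_⟩
  · intro h
    have := congrArg List.length h
    simp at this
    rcases this with h | h
    · omega
    · subst h; simp at hd'; omega
  intro k hk hkd
  have hlen : (T.take d).length = d := by simp; omega
  rw [hlen] at hkd
  have hT : T.take d ++ T.drop d = T := List.take_append_drop d T
  have hTk : (T.take d).drop k ++ T.drop d = T.drop k := by
    conv_rhs => rw [← hT]
    rw [List.drop_append_of_le_length (by omega)]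
  rcases lex_tri (T.take d) ((T.take d).drop k) with h | h | h
  · exact h
  · have := congrArg List.length h
    rw [List.length_drop] at this; omega
  · exfalso
    rcases lexB h with ⟨x, hx⟩ | h
    · have h3 := hmin' k hk hkd
      have hul : ((T.take d).drop k).length = d - k := by rw [List.length_drop, hlen]
      have e : T = (T.take d).drop k ++ (x ++ T.drop d) := by
        rw [← List.append_assoc, ← hx, hT]
      have e2 : T.drop (d - k) = x ++ T.drop d := by
        conv_lhs => rw [e]
        exact List.drop_left' hul
      rw [← hTk] at h3
      have h4 := hmin' (d - k) (by omega) (by omega)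
      have h5 : List.Lex (· < ·) (x ++ T.drop d) (T.drop d) := by
        apply lexC ((T.take d).drop k)
        rw [← e]; exact h3
      rw [e2] at h4
      exact lex_irr T (lex_tr h4 (lex_tr h5 hlt))
    · have := h (T.drop d) (T.drop d)
      rw [hT, hTk] at this
      exact hmin k hk hkd this

theorem core2 (T : List α) (d l : ℕ) (hd : 0 < d) (hl : d < l) (hl' : l ≤ T.length)
    (hlt : List.Lex (· < ·) (T.drop d) T) : ¬ IsLyndon (T.take l) := by
  intro h
  have hlen : (T.take l).length = l := by simp; omega
  have h1 := h.2 d hd (by omega)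
  have hT : T.take l ++ T.drop l = T := List.take_append_drop l T
  rcases lexB h1 with ⟨x, hx⟩ | h1
  · have := congrArg List.length hx
    rw [List.length_drop, List.length_append] at this; omega
  · have := h1 (T.drop l) (T.drop l)
    rw [← List.drop_append_of_le_length (by omega), hT] at this
    exact lex_irr _ (lex_tr this hlt)

/-- the length of the longest Lyndon word starting at position `i`
equals `nss i − i`. -/
theorem stmt3 (S : List α) (i : ℕ) (h1 : 1 ≤ i) (h2 : i ≤ S.length) :
    lam S i = nss S i - i := by
  have hne : {j | i < j ∧ j ≤ S.length + 1 ∧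
      List.Lex (· < ·) (sfx S j) (sfx S i)}.Nonempty := by
    refine ⟨S.length + 1, by omega, le_refl _, ?_⟩
    have e : sfx S (S.length + 1) = [] := by simp [sfx]
    have e2 : sfx S i ≠ [] := by
      unfold sfx
      rw [if_neg (by omega)]
      intro h
      have := congrArg List.length h
      simp at this; omega
    rw [e]
    cases h : sfx S i with
    | nil => exact absurd h e2
    | cons a t => exact List.Lex.nil
  have hm := Nat.sInf_mem hne
  have hmin : ∀ j, j < nss S i → ¬ (i < j ∧ j ≤ S.length + 1 ∧
      List.Lex (· < ·) (sfx S j) (sfx S i)) := fun j hj => Nat.notMem_of_lt_sInf hj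
  change i < nss S i ∧ nss S i ≤ S.length + 1 ∧
      List.Lex (· < ·) (sfx S (nss S i)) (sfx S i) at hm
  obtain ⟨ha, hb, hc⟩ := hm
  have key : ∀ k, sfx S (i + k) = (S.drop (i - 1)).drop k := by
    intro k
    rw [sfx, if_neg (by omega), List.drop_drop]
    congr 1; omega
  have key0 : sfx S i = S.drop (i - 1) := by rw [sfx, if_neg (by omega)]
  obtain ⟨d, hd⟩ : ∃ d, nss S i = i + d := ⟨nss S i - i, by omega⟩
  rw [hd] at ha hb hc hmin ⊢
  rw [key, key0] at hc
  have hTl : (S.drop (i - 1)).length = S.length + 1 - i := by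
    rw [List.length_drop]; omega
  classical
  rw [Nat.add_sub_cancel_left, lam]
  refine Nat.findGreatest_eq_iff.mpr ?_
  refine ⟨by omega, fun _ => ?_, fun l hl hl' => ?_⟩
  · refine core1 _ d (by omega) (by omega) hc ?_
    intro k hk hkd h
    refine hmin (i + k) (by omega) ⟨by omega, by omega, ?_⟩
    rw [key, key0]; exact h
  · exact core2 _ d l (by omega) hl (by omega) hc
end

section
/- For a string S of length n (with distinct suffixes) and any index i, if r is the largest descendant of i in the PSS tree (so descendants of i are exactly (i, r]), then either r = n and S_j ≻ S_i for all j ∈ (i, n], or r < n and S_{r+1} is lexicographically smaller than every suffix S_j with j ∈ [i, r]; in both cases nss(i) = r + 1. -/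
variable {α : Type*} [LinearOrder α]

theorem sfx_len_aux (S : List α) (k : ℕ) (hk : 1 ≤ k) : (sfx S k).length = S.length - (k - 1) := by
  unfold sfx
  rw [if_neg (by omega), List.length_drop]

theorem lex_nil_aux (S : List α) (j : ℕ) (h1 : 1 ≤ j) (h2 : j ≤ S.length) :
    List.Lex (· < ·) ([] : List α) (sfx S j) := by
  have h := sfx_len_aux S j h1
  cases hs : sfx S j with
  | nil => rw [hs] at h; simp at h; omega
  | cons a l => exact List.Lex.nil

theorem pss_lex_aux (S : List α) (j : ℕ) (h1 : 1 ≤ j) (h2 : j ≤ S.length) :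
    List.Lex (· < ·) (sfx S (pss S j)) (sfx S j) := by
  classical
  unfold pss
  refine Nat.findGreatest_spec (P := fun k => List.Lex (· < ·) (sfx S k) (sfx S j))
    (Nat.zero_le _) ?_
  have := lex_nil_aux S j h1 h2
  simpa [sfx] using this

theorem pss_le_aux (S : List α) (j : ℕ) : pss S j ≤ j - 1 := by
  classical
  exact Nat.findGreatest_le _

theorem pss_between_aux (S : List α) (j k : ℕ) (h2 : j ≤ S.length)
    (hk : pss S j < k) (hkj : k < j) :
    List.Lex (· < ·) (sfx S j) (sfx S k) := by
  classical
  have hn : ¬ List.Lex (· < ·) (sfx S k) (sfx S j) :=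
    Nat.findGreatest_is_greatest (P := fun k => List.Lex (· < ·) (sfx S k) (sfx S j)) hk (by omega)
  have hne : sfx S j ≠ sfx S k := by
    intro h
    have := congrArg List.length h
    rw [sfx_len_aux S j (by omega), sfx_len_aux S k (by omega)] at this
    omega
  rcases lt_trichotomy (sfx S j) (sfx S k) with h | h | h
  · exact h
  · exact absurd h hne
  · exact absurd h hn

theorem iter_lex_aux (S : List α) (i : ℕ) (hi : 1 ≤ i) (m : ℕ) : ∀ j, j ≤ S.length →
    (pss S)^[m + 1] j = i → List.Lex (· < ·) (sfx S i) (sfx S j) := by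
  have h0 : pss S 0 = 0 := by have := pss_le_aux S 0; omega
  induction m with
  | zero =>
    intro j hj h
    simp only [zero_add, Function.iterate_one] at h
    have hj1 : 1 ≤ j := by
      rcases Nat.eq_zero_or_pos j with rfl | h'
      · omega
      · exact h'
    rw [← h]
    exact pss_lex_aux S j hj1 hj
  | succ m ih =>
    intro j hj h
    have hj1 : 1 ≤ j := by
      rcases Nat.eq_zero_or_pos j with rfl | h'
      · rw [Function.iterate_fixed h0] at h; omega
      · exact h'
    rw [Function.iterate_succ_apply] at h
    have hle := pss_le_aux S j
    have a := ih (pss S j) (by omega) h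
    have b := pss_lex_aux S j hj1 hj
    exact lt_trans (show sfx S i < sfx S (pss S j) from a) b

/-- if the descendants of node `i` in the PSS tree are exactly the interval
`(i, r]`, then either `r = n` and `S_j ≻ S_i` for all `j ∈ (i, n]`, or `r < n` and
`S_{r+1}` is smaller than every suffix `S_j` with `j ∈ [i, r]`; in both cases
`nss i = r + 1`. -/
theorem stmt19 (S : List α) (i r : ℕ) (hi1 : 1 ≤ i) (hin : i ≤ S.length)
    (hir : i ≤ r) (hrn : r ≤ S.length)
    (hdesc : ∀ j, j ≤ S.length →
      ((∃ m, 0 < m ∧ (pss S)^[m] j = i) ↔ (i < j ∧ j ≤ r))) :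
    ((r = S.length ∧ ∀ j, i < j → j ≤ S.length →
        List.Lex (· < ·) (sfx S i) (sfx S j)) ∨
     (r < S.length ∧ ∀ j, i ≤ j → j ≤ r →
        List.Lex (· < ·) (sfx S (r + 1)) (sfx S j))) ∧
    nss S i = r + 1 := by
  have hA : ∀ j, i < j → j ≤ r → List.Lex (· < ·) (sfx S i) (sfx S j) := by
    intro j h1 h2
    obtain ⟨m, hm, h⟩ := (hdesc j (by omega)).2 ⟨h1, h2⟩
    obtain ⟨m, rfl⟩ : ∃ m', m = m' + 1 := ⟨m - 1, by omega⟩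
    exact iter_lex_aux S i hi1 m j (by omega) h
  have hB : r < S.length → ∀ j, i ≤ j → j ≤ r →
      List.Lex (· < ·) (sfx S (r + 1)) (sfx S j) := by
    intro hr j h1 h2
    have hnd : ¬ ∃ m, 0 < m ∧ (pss S)^[m] (r + 1) = i := by
      rw [hdesc (r + 1) (by omega)]; omega
    have hle := pss_le_aux S (r + 1)
    have hlt : pss S (r + 1) < i := by
      by_contra hc
      rcases Nat.eq_or_lt_of_le (Nat.le_of_not_lt hc) with he | hl
      · exact hnd ⟨1, one_pos, he.symm⟩
      · obtain ⟨m, hm, h⟩ := (hdesc (pss S (r + 1)) (by omega)).2 ⟨hl, by omega⟩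
        exact hnd ⟨m + 1, by omega, by rw [Function.iterate_succ_apply]; exact h⟩
    exact pss_between_aux S (r + 1) j (by omega) (by omega) (by omega)
  refine ⟨?_, ?_⟩
  · rcases Nat.eq_or_lt_of_le hrn with he | hl
    · exact Or.inl ⟨he, fun j h1 h2 => hA j h1 (by omega)⟩
    · exact Or.inr ⟨hl, hB hl⟩
  · have hmem : List.Lex (· < ·) (sfx S (r + 1)) (sfx S i) := by
      rcases Nat.eq_or_lt_of_le hrn with he | hl
      · have hz : sfx S (r + 1) = [] := by
          apply List.eq_nil_of_length_eq_zero
          rw [sfx_len_aux S (r + 1) (by omega)]; omega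
        rw [hz]
        exact lex_nil_aux S i hi1 hin
      · exact hB hl i le_rfl hir
    have hL : IsLeast {j | i < j ∧ j ≤ S.length + 1 ∧
        List.Lex (· < ·) (sfx S j) (sfx S i)} (r + 1) := by
      refine ⟨⟨by omega, by omega, hmem⟩, ?_⟩
      rintro j ⟨h1, h2, h3⟩
      by_contra hc
      have h4 := hA j h1 (by omega)
      exact lt_asymm (show sfx S i < sfx S j from h4) h3
    exact hL.csInf_eq
end
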